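/- For every integer k ≥ 0 and real δ > -1, the unique solution (p_{i_0,…,i_k})_{1≤i_k<⋯<i_0} of the recursion p_{i_0,…,i_k} = ((i_k-1+δ)/τ) p_{i_0-1,…,i_k-1} + Σ_{m=0}^{k-1} (((i_m-1-k+m)b_m − (i_{m+1}-k+m+1)b_{m+1})/τ) p_{i_0-1,…,i_m-1,i_{m+1},…,i_k} − (((i_0-k)b_0+δ)/τ) p_{i_0,…,i_k} + 1{i_ℓ = k-ℓ+1 for all ℓ=0,…,k} (terms with index vectors violating 1 ≤ i_k < ⋯ < i_0 set to 0) is a probability mass function: p_{i_0,…,i_k} ≥ 0 for all 1 ≤ i_k < ⋯ < i_0 and Σ_{1≤i_k<⋯<i_0} p_{i_0,…,i_k} = 1. -/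

import Mathlib

open MeasureTheory Filter Finset

noncomputable section

/-- The coefficient `b_m = k - m + 1 + δ(k - m)`. -/
def bcoef (k : ℕ) (δ : ℝ) (m : ℕ) : ℝ := (k : ℝ) - m + 1 + δ * ((k : ℝ) - m)

/-- The coefficient `τ = k + 2 + δ(k + 1)`. -/
def tauc (k : ℕ) (δ : ℝ) : ℝ := (k : ℝ) + 2 + δ * ((k : ℝ) + 1)

/-- A vector `(i_0, …, i_k)` of degrees is valid when `1 ≤ i_k < i_{k-1} < ⋯ < i_0`. -/
def ValidIdx (k : ℕ) (i : Fin (k + 1) → ℕ) : Prop :=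
  1 ≤ i (Fin.last k) ∧ StrictAnti i

/-- Decrease every coordinate of the index vector by one. -/
def allDec (k : ℕ) (i : Fin (k + 1) → ℕ) : Fin (k + 1) → ℕ := fun ℓ => i ℓ - 1

/-- Decrease the coordinates `0, …, m` of the index vector by one. -/
def decUpTo (k : ℕ) (m : ℕ) (i : Fin (k + 1) → ℕ) : Fin (k + 1) → ℕ :=
  fun ℓ => if (ℓ : ℕ) ≤ m then i ℓ - 1 else i ℓ

/-- The limiting degree recursion: `p` vanishes outside the valid index vectors, and on the
valid index vectors it satisfies the recursion of Theorem 2.1 of the paper. -/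
def LimitRecursion (k : ℕ) (δ : ℝ) (p : (Fin (k + 1) → ℕ) → ℝ) : Prop :=
  (∀ i, ¬ ValidIdx k i → p i = 0) ∧
  ∀ i, ValidIdx k i →
    p i = ((i (Fin.last k) : ℝ) - 1 + δ) / tauc k δ * p (allDec k i)
      + (∑ m : Fin k,
          (((i m.castSucc : ℝ) - 1 - k + (m : ℕ)) * bcoef k δ (m : ℕ)
            - ((i m.succ : ℝ) - k + (m : ℕ) + 1) * bcoef k δ ((m : ℕ) + 1)) / tauc k δ
            * p (decUpTo k (m : ℕ) i))
      - (((i 0 : ℝ) - k) * bcoef k δ 0 + δ) / tauc k δ * p i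
      + (if ∀ ℓ : Fin (k + 1), i ℓ = k - (ℓ : ℕ) + 1 then (1 : ℝ) else 0)

/-- Increase the coordinates `0, …, m` of the index vector by one. -/
def incUpTo (k m : ℕ) (i : Fin (k + 1) → ℕ) : Fin (k + 1) → ℕ :=
  fun ℓ => if (ℓ : ℕ) ≤ m then i ℓ + 1 else i ℓ

/-- The mass flowing into the state `i` under `p`, excluding the source term. -/
def inflow (k : ℕ) (δ : ℝ) (p : (Fin (k + 1) → ℕ) → ℝ) (i : Fin (k + 1) → ℕ) : ℝ :=
  ((i (Fin.last k) : ℝ) - 1 + δ) / tauc k δ * p (allDec k i)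
    + ∑ m : Fin k,
        (((i m.castSucc : ℝ) - 1 - k + (m : ℕ)) * bcoef k δ (m : ℕ)
          - ((i m.succ : ℝ) - k + (m : ℕ) + 1) * bcoef k δ ((m : ℕ) + 1)) / tauc k δ
          * p (decUpTo k (m : ℕ) i)

/-- The total rate of leaving a state whose largest coordinate is `n`. -/
def outRate (k : ℕ) (δ : ℝ) (n : ℕ) : ℝ := (((n : ℝ) - k) * bcoef k δ 0 + δ) / tauc k δ

/-- The source term of the recursion. -/
def source (k : ℕ) (i : Fin (k + 1) → ℕ) : ℝ :=
  if ∀ ℓ : Fin (k + 1), i ℓ = k - (ℓ : ℕ) + 1 then 1 else 0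

lemma source_nonneg (k : ℕ) (i : Fin (k + 1) → ℕ) : 0 ≤ source k i := by
  unfold source; split_ifs <;> norm_num

lemma allDec_eq_decUpTo (k : ℕ) (i : Fin (k + 1) → ℕ) : allDec k i = decUpTo k k i := by
  funext ℓ
  simp [allDec, decUpTo, Nat.lt_succ_iff.mp ℓ.isLt]

lemma decUpTo_zero (k m : ℕ) (i : Fin (k + 1) → ℕ) : decUpTo k m i 0 = i 0 - 1 := by
  simp [decUpTo]

lemma allDec_zero (k : ℕ) (i : Fin (k + 1) → ℕ) : allDec k i 0 = i 0 - 1 := rfl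

lemma tauc_pos (k : ℕ) {δ : ℝ} (hδ : -1 < δ) : 0 < tauc k δ := by
  have : tauc k δ = (1 + δ) * (k + 1) + 1 := by unfold tauc; ring
  have h1 : 0 < 1 + δ := by linarith
  rw [this]; positivity

lemma ValidIdx.add_le {k : ℕ} {i : Fin (k + 1) → ℕ} (h : ValidIdx k i) (ℓ : Fin (k + 1)) :
    k + 1 ≤ i ℓ + ℓ := by
  induction ℓ using Fin.reverseInduction with
  | last => have := h.1; simp only [Fin.val_last]; omega
  | cast m ih =>
    have := h.2 m.castSucc_lt_succ
    simp only [Fin.val_succ, Fin.val_castSucc] at ih ⊢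
    omega

lemma ValidIdx.pos {k : ℕ} {i : Fin (k + 1) → ℕ} (h : ValidIdx k i) (ℓ : Fin (k + 1)) :
    1 ≤ i ℓ := by
  have := h.add_le ℓ
  omega

lemma ValidIdx.le_zero {k : ℕ} {i : Fin (k + 1) → ℕ} (h : ValidIdx k i) (ℓ : Fin (k + 1)) :
    i ℓ ≤ i 0 := h.2.antitone (Fin.zero_le ℓ)

lemma ValidIdx.incUpTo {k : ℕ} {i : Fin (k + 1) → ℕ} (h : ValidIdx k i) (m : ℕ) :
    ValidIdx k (incUpTo k m i) := by
  refine ⟨?_, fun a b hab => ?_⟩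
  · have := h.1
    unfold _root_.incUpTo; split_ifs <;> omega
  · have h1 := h.2 hab
    have h2 : (a : ℕ) < b := hab
    unfold _root_.incUpTo; split_ifs <;> omega

lemma incUpTo_zero (k m : ℕ) (i : Fin (k + 1) → ℕ) : incUpTo k m i 0 = i 0 + 1 := by
  simp [incUpTo]

lemma decUpTo_incUpTo (k m : ℕ) (i : Fin (k + 1) → ℕ) :
    decUpTo k m (incUpTo k m i) = i := by
  funext ℓ
  unfold decUpTo incUpTo
  split_ifs <;> omega

lemma incUpTo_decUpTo (k m : ℕ) {i : Fin (k + 1) → ℕ} (h : ∀ ℓ, 1 ≤ i ℓ) :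
    incUpTo k m (decUpTo k m i) = i := by
  funext ℓ
  have := h ℓ
  simp only [decUpTo, incUpTo]
  split_ifs <;> omega

lemma one_le_bcoef_zero (k : ℕ) {δ : ℝ} (hδ : -1 < δ) : 1 ≤ bcoef k δ 0 := by
  have : bcoef k δ 0 = (1 + δ) * k + 1 := by unfold bcoef; push_cast; ring
  have h1 : 0 ≤ (1 + δ) * k := mul_nonneg (by linarith) (by positivity)
  linarith

lemma outRate_pos {k : ℕ} {δ : ℝ} (hδ : -1 < δ) {n : ℕ} (hn : k + 1 ≤ n) :
    0 < outRate k δ n := by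
  refine div_pos ?_ (tauc_pos k hδ)
  have h1 := one_le_bcoef_zero k hδ
  have h2 : (1 : ℝ) ≤ (n : ℝ) - k := by
    have : ((k + 1 : ℕ) : ℝ) ≤ n := by exact_mod_cast hn
    push_cast at this; linarith
  nlinarith

/-- The recursion in the form in which the value at `i` is determined by lower levels. -/
lemma limitRecursion_iff {k : ℕ} {δ : ℝ} {p : (Fin (k + 1) → ℕ) → ℝ} :
    LimitRecursion k δ p ↔ (∀ i, ¬ ValidIdx k i → p i = 0) ∧
      ∀ i, ValidIdx k i → p i * (1 + outRate k δ (i 0)) = inflow k δ p i + source k i := by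
  refine and_congr_right fun _ => forall₂_congr fun i _ => ?_
  unfold inflow outRate source
  constructor <;> intro h <;> linarith

lemma inflow_congr {k : ℕ} (δ : ℝ) {p q : (Fin (k + 1) → ℕ) → ℝ} {i : Fin (k + 1) → ℕ}
    (h : ∀ j, j 0 = i 0 - 1 → p j = q j) : inflow k δ p i = inflow k δ q i := by
  unfold inflow
  rw [h _ (allDec_zero k i)]
  congr 1
  exact Finset.sum_congr rfl fun m _ => by rw [h _ (decUpTo_zero k m i)]

lemma LimitRecursion.unique {k : ℕ} {δ : ℝ} (hδ : -1 < δ) {p q : (Fin (k + 1) → ℕ) → ℝ}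
    (hp : LimitRecursion k δ p) (hq : LimitRecursion k δ q) : p = q := by
  rw [limitRecursion_iff] at hp hq
  suffices h : ∀ n, ∀ i : Fin (k + 1) → ℕ, i 0 = n → p i = q i from funext fun i => h _ i rfl
  intro n
  induction n with
  | zero =>
    intro i hi
    have : ¬ ValidIdx k i := fun hv => by have := hv.pos 0; omega
    rw [hp.1 i this, hq.1 i this]
  | succ n ih =>
    intro i hi
    by_cases hv : ValidIdx k i
    · have hpos := outRate_pos hδ (n := i 0) (by simpa using hv.add_le 0)
      have hin : inflow k δ p i = inflow k δ q i :=
        inflow_congr δ fun j hj => ih j (by omega)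
      have := (hp.2 i hv).trans ((congrArg (· + source k i) hin).trans (hq.2 i hv).symm)
      exact mul_right_cancel₀ (by positivity) this
    · rw [hp.1 i hv, hq.1 i hv]

open Classical in
/-- The solution of the recursion, computed level by level. -/
def levelSolution (k : ℕ) (δ : ℝ) : ℕ → (Fin (k + 1) → ℕ) → ℝ
  | 0, _ => 0
  | n + 1, i => if ValidIdx k i then
      (inflow k δ (levelSolution k δ n) i + source k i) / (1 + outRate k δ (i 0)) else 0

lemma exists_limitRecursion (k : ℕ) {δ : ℝ} (hδ : -1 < δ) : ∃ p, LimitRecursion k δ p := by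
  refine ⟨fun i => levelSolution k δ (i 0) i, limitRecursion_iff.mpr ⟨fun i hi => ?_, ?_⟩⟩
  · cases h : i 0 <;> simp [levelSolution, hi]
  · intro i hi
    have hpos := outRate_pos hδ (n := i 0) (by simpa using hi.add_le 0)
    obtain ⟨n, hn⟩ : ∃ n, i 0 = n + 1 := ⟨i 0 - 1, by have := hi.pos 0; omega⟩
    have hin : inflow k δ (fun j => levelSolution k δ (j 0) j) i
        = inflow k δ (levelSolution k δ n) i :=
      inflow_congr δ fun j hj => by rw [hj, hn, Nat.add_sub_cancel]
    rw [hin]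
    simp only [hn, levelSolution, if_pos hi]
    rw [hn] at hpos
    exact div_mul_cancel₀ _ (by positivity)

lemma LimitRecursion.nonneg {k : ℕ} {δ : ℝ} (hδ : -1 < δ) {p : (Fin (k + 1) → ℕ) → ℝ}
    (hp : LimitRecursion k δ p) (i : Fin (k + 1) → ℕ) : 0 ≤ p i := by
  rw [limitRecursion_iff] at hp
  suffices h : ∀ n, ∀ i : Fin (k + 1) → ℕ, i 0 = n → 0 ≤ p i from h _ i rfl
  intro n
  have hτ := tauc_pos k hδ
  induction n with
  | zero =>
    intro i hi
    exact (hp.1 i fun hv => by have := hv.pos 0; omega).ge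
  | succ n ih =>
    intro i hi
    by_cases hv : ValidIdx k i
    swap
    · exact (hp.1 i hv).ge
    have hpos := outRate_pos hδ (n := i 0) (by simpa using hv.add_le 0)
    refine nonneg_of_mul_nonneg_left ?_ (by positivity : 0 < 1 + outRate k δ (i 0))
    rw [hp.2 i hv]
    refine add_nonneg (add_nonneg ?_ (Finset.sum_nonneg fun m _ => ?_)) (source_nonneg k i)
    · by_cases hd : ValidIdx k (allDec k i)
      · have h1 : (2 : ℝ) ≤ i (Fin.last k) := by
          have := hd.1
          unfold allDec at this
          exact_mod_cast (by omega : 2 ≤ i (Fin.last k))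
        exact mul_nonneg (div_nonneg (by linarith) hτ.le)
          (ih _ (by rw [allDec_zero]; omega))
      · rw [hp.1 _ hd, mul_zero]
    · by_cases hd : ValidIdx k (decUpTo k m i)
      · refine mul_nonneg (div_nonneg ?_ hτ.le) (ih _ (by rw [decUpTo_zero]; omega))
        have h1 : ((i m.succ : ℝ) + 1) + 1 ≤ i m.castSucc := by
          have := hd.2 m.castSucc_lt_succ
          simp only [decUpTo, Fin.val_succ, Fin.val_castSucc, le_refl, if_true] at this
          rw [if_neg (by omega)] at this
          exact_mod_cast (by omega : i m.succ + 1 + 1 ≤ i m.castSucc)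
        have h2 : (0 : ℝ) ≤ (i m.succ : ℝ) - k + m := by
          have := hv.add_le m.succ
          simp only [Fin.val_succ] at this
          have : ((k : ℕ) : ℝ) ≤ (i m.succ + m : ℕ) := by exact_mod_cast (by omega)
          push_cast at this; linarith
        have h3 : bcoef k δ m = bcoef k δ (m + 1) + (1 + δ) := by
          unfold bcoef; push_cast; ring
        have h4 : 0 ≤ bcoef k δ m := by
          have hm : ((m : ℕ) : ℝ) ≤ k := by exact_mod_cast m.isLt.le
          have : bcoef k δ m = (1 + δ) * (k - m) + 1 := by unfold bcoef; ring
          rw [this]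
          have := mul_nonneg (by linarith : 0 ≤ 1 + δ) (sub_nonneg.mpr hm)
          linarith
        nlinarith [mul_nonneg (by linarith : (0 : ℝ) ≤ i m.castSucc - i m.succ - 1 - 1) h4,
          mul_nonneg h2 (by linarith : 0 ≤ 1 + δ)]
      · rw [hp.1 _ hd, mul_zero]

open Classical in
/-- The valid index vectors whose largest coordinate is at most `n`. -/
def validUpTo (k n : ℕ) : Finset (Fin (k + 1) → ℕ) :=
  (Fintype.piFinset fun _ => Finset.range (n + 1)).filter (ValidIdx k)

/-- The valid index vectors whose largest coordinate is equal to `n`. -/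
def validLevel (k n : ℕ) : Finset (Fin (k + 1) → ℕ) :=
  (validUpTo k n).filter fun i => i 0 = n

lemma mem_validUpTo {k n : ℕ} {i : Fin (k + 1) → ℕ} :
    i ∈ validUpTo k n ↔ ValidIdx k i ∧ i 0 ≤ n := by
  simp only [validUpTo, Finset.mem_filter, Fintype.mem_piFinset, Finset.mem_range, Nat.lt_succ_iff]
  exact ⟨fun h => ⟨h.2, h.1 0⟩, fun h => ⟨fun ℓ => (h.1.le_zero ℓ).trans h.2, h.1⟩⟩

lemma mem_validLevel {k n : ℕ} {i : Fin (k + 1) → ℕ} :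
    i ∈ validLevel k n ↔ ValidIdx k i ∧ i 0 = n := by
  simp only [validLevel, Finset.mem_filter, mem_validUpTo]
  exact ⟨fun h => ⟨h.1.1, h.2⟩, fun h => ⟨⟨h.1, h.2.le⟩, h.2⟩⟩

lemma sum_validUpTo_succ (k n : ℕ) (p : (Fin (k + 1) → ℕ) → ℝ) :
    ∑ i ∈ validUpTo k (n + 1), p i
      = ∑ i ∈ validUpTo k n, p i + ∑ i ∈ validLevel k (n + 1), p i := by
  classical
  rw [← Finset.sum_union]
  · congr 1
    ext i
    simp only [Finset.mem_union, mem_validUpTo, mem_validLevel, ← and_or_left,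
      Nat.le_add_one_iff]
  · refine Finset.disjoint_left.mpr fun i h1 h2 => ?_
    rw [mem_validUpTo] at h1
    rw [mem_validLevel] at h2
    omega

lemma validUpTo_zero (k : ℕ) : validUpTo k 0 = ∅ := by
  refine Finset.eq_empty_of_forall_notMem fun i hi => ?_
  rw [mem_validUpTo] at hi
  have := hi.1.pos 0
  omega

lemma sum_validLevel_decUpTo {k : ℕ} {p : (Fin (k + 1) → ℕ) → ℝ}
    (hp : ∀ i, ¬ ValidIdx k i → p i = 0) (w : (Fin (k + 1) → ℕ) → ℝ) (m n : ℕ) :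
    ∑ i ∈ validLevel k (n + 1), w i * p (decUpTo k m i)
      = ∑ j ∈ validLevel k n, w (incUpTo k m j) * p j := by
  symm
  refine Finset.sum_of_injOn (incUpTo k m) ?_ ?_ ?_ ?_
  · exact (Function.LeftInverse.injective (decUpTo_incUpTo k m)).injOn
  · intro j hj
    rw [Finset.mem_coe, mem_validLevel] at hj ⊢
    exact ⟨hj.1.incUpTo m, by rw [incUpTo_zero, hj.2]⟩
  · intro i hi hni
    rw [mem_validLevel] at hi
    rw [hp, mul_zero]
    intro hv
    refine hni ⟨decUpTo k m i, ?_, incUpTo_decUpTo k m hi.1.pos⟩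
    rw [Finset.mem_coe, mem_validLevel]
    exact ⟨hv, by rw [decUpTo_zero, hi.2, Nat.add_sub_cancel]⟩
  · intro j _
    rw [decUpTo_incUpTo]

lemma sum_rates {k : ℕ} (δ : ℝ) (j : Fin (k + 1) → ℕ) :
    ((incUpTo k k j (Fin.last k) : ℝ) - 1 + δ) / tauc k δ
      + ∑ m : Fin k, (((incUpTo k m j m.castSucc : ℝ) - 1 - k + (m : ℕ)) * bcoef k δ (m : ℕ)
          - ((incUpTo k m j m.succ : ℝ) - k + (m : ℕ) + 1) * bcoef k δ ((m : ℕ) + 1)) / tauc k δ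
      = outRate k δ (j 0) := by
  let g : Fin (k + 1) → ℝ := fun ℓ => ((j ℓ : ℝ) - k + (ℓ : ℕ)) * bcoef k δ ℓ / tauc k δ
  have hterm : ∀ m : Fin k,
      (((incUpTo k m j m.castSucc : ℝ) - 1 - k + (m : ℕ)) * bcoef k δ (m : ℕ)
          - ((incUpTo k m j m.succ : ℝ) - k + (m : ℕ) + 1) * bcoef k δ ((m : ℕ) + 1)) / tauc k δ
        = g m.castSucc - g m.succ := by
    intro m
    simp only [g, incUpTo, Fin.val_castSucc, Fin.val_succ, le_refl, if_true]
    rw [if_neg (by omega)]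
    push_cast
    ring
  have htel : ∑ m : Fin k, (g m.castSucc - g m.succ) = g 0 - g (Fin.last k) := by
    rw [Finset.sum_sub_distrib]
    have := (Fin.sum_univ_castSucc g).symm.trans (Fin.sum_univ_succ g)
    linarith
  rw [Finset.sum_congr rfl fun m _ => hterm m, htel]
  simp only [g, incUpTo, outRate, bcoef, Fin.val_last, Fin.val_zero, le_refl, if_true]
  push_cast
  ring

lemma sum_inflow {k : ℕ} (δ : ℝ) {p : (Fin (k + 1) → ℕ) → ℝ}
    (hp : ∀ i, ¬ ValidIdx k i → p i = 0) (n : ℕ) :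
    ∑ i ∈ validLevel k (n + 1), inflow k δ p i
      = outRate k δ n * ∑ j ∈ validLevel k n, p j := by
  simp only [inflow, allDec_eq_decUpTo]
  rw [Finset.sum_add_distrib, Finset.sum_comm,
    sum_validLevel_decUpTo hp (fun i => ((i (Fin.last k) : ℝ) - 1 + δ) / tauc k δ)]
  rw [Finset.sum_congr rfl fun (m : Fin k) _ => sum_validLevel_decUpTo hp
    (fun i => (((i m.castSucc : ℝ) - 1 - k + (m : ℕ)) * bcoef k δ (m : ℕ)
      - ((i m.succ : ℝ) - k + (m : ℕ) + 1) * bcoef k δ ((m : ℕ) + 1)) / tauc k δ) m n]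
  rw [Finset.sum_comm, ← Finset.sum_add_distrib, Finset.mul_sum]
  refine Finset.sum_congr rfl fun j hj => ?_
  rw [← Finset.sum_mul, ← add_mul, sum_rates, (mem_validLevel.mp hj).2]

lemma validIdx_base (k : ℕ) : ValidIdx k fun ℓ => k - (ℓ : ℕ) + 1 := by
  refine ⟨by simp, fun a b hab => ?_⟩
  have h1 : (a : ℕ) < b := hab
  have h2 := b.isLt
  dsimp only
  omega

lemma sum_source (k n : ℕ) :
    ∑ i ∈ validLevel k n, source k i = if n = k + 1 then 1 else 0 := by
  classical
  have h : ∀ i, source k i = if i = (fun ℓ : Fin (k + 1) => k - (ℓ : ℕ) + 1) then 1 else 0 := by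
    intro i
    simp only [source, funext_iff]
  simp only [h, Finset.sum_ite_eq', mem_validLevel, validIdx_base, true_and, Fin.val_zero,
    Nat.sub_zero, eq_comm]

lemma LimitRecursion.sum_validLevel_succ {k : ℕ} {δ : ℝ} {p : (Fin (k + 1) → ℕ) → ℝ}
    (hp : LimitRecursion k δ p) (n : ℕ) :
    (∑ i ∈ validLevel k (n + 1), p i) * (1 + outRate k δ (n + 1))
      = outRate k δ n * ∑ i ∈ validLevel k n, p i + if n = k then 1 else 0 := by
  rw [limitRecursion_iff] at hp
  have h := sum_source k (n + 1)
  simp only [Nat.add_right_cancel_iff] at h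
  rw [← sum_inflow δ hp.1, ← h, ← Finset.sum_add_distrib, Finset.sum_mul]
  refine Finset.sum_congr rfl fun i hi => ?_
  rw [mem_validLevel] at hi
  rw [← hi.2]
  exact hp.2 i hi.1

lemma LimitRecursion.sum_validUpTo {k : ℕ} {δ : ℝ} {p : (Fin (k + 1) → ℕ) → ℝ}
    (hp : LimitRecursion k δ p) (n : ℕ) :
    ∑ i ∈ validUpTo k n, p i
      = (if k + 1 ≤ n then 1 else 0) - outRate k δ n * ∑ i ∈ validLevel k n, p i := by
  induction n with
  | zero => simp [validUpTo_zero, validLevel]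
  | succ n ih =>
    have h := hp.sum_validLevel_succ n
    rw [sum_validUpTo_succ, ih]
    have hif : (if k + 1 ≤ n + 1 then (1 : ℝ) else 0)
        = (if k + 1 ≤ n then 1 else 0) + if n = k then 1 else 0 := by
      split_ifs <;> first | omega | norm_num
    rw [hif]
    linarith

lemma outRate_le (k : ℕ) {δ : ℝ} (hδ : -1 < δ) {n : ℕ} (hn : 1 ≤ n) :
    outRate k δ n ≤ (bcoef k δ 0 + |δ|) / tauc k δ * n := by
  rw [div_mul_eq_mul_div]
  refine div_le_div_of_nonneg_right ?_ (tauc_pos k hδ).le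
  have h1 : (1 : ℝ) ≤ n := by exact_mod_cast hn
  have h2 := mul_nonneg (Nat.cast_nonneg (α := ℝ) k)
    (zero_le_one.trans (one_le_bcoef_zero k hδ))
  have h3 := mul_le_mul_of_nonneg_left h1 (abs_nonneg δ)
  have h4 := le_abs_self δ
  linarith

/-- The harmonic series diverges, so a summable sequence is not bounded below by a positive
multiple of `1 / n`. -/
lemma nonpos_of_summable_of_eventually_le {s : ℕ → ℝ} {c C : ℝ} (hs : Summable s)
    (h : ∀ᶠ n : ℕ in atTop, c ≤ C * n * s n) : c ≤ 0 := by
  by_contra! hc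
  refine Real.not_summable_one_div_natCast
    (Summable.of_norm_bounded_eventually_nat (hs.mul_left (C / c)) ?_)
  filter_upwards [h, eventually_ge_atTop 1] with n hn h1
  have hn0 : (0 : ℝ) < n := by exact_mod_cast h1
  rw [Real.norm_of_nonneg (by positivity), div_le_iff₀ hn0, div_mul_eq_mul_div, div_mul_eq_mul_div,
    le_div_iff₀ hc]
  linarith

lemma LimitRecursion.hasSum {k : ℕ} {δ : ℝ} (hδ : -1 < δ) {p : (Fin (k + 1) → ℕ) → ℝ}
    (hp : LimitRecursion k δ p) : HasSum p 1 := by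
  classical
  have hnn := hp.nonneg hδ
  have hlev : ∀ n, 0 ≤ ∑ i ∈ validLevel k n, p i := fun n => Finset.sum_nonneg fun i _ => hnn i
  let B : ℕ → Finset (Fin (k + 1) → ℕ) := fun n => Fintype.piFinset fun _ => Finset.range (n + 1)
  have hB : ∀ n, ∑ i ∈ B n, p i = ∑ i ∈ validUpTo k n, p i := fun n =>
    (Finset.sum_filter_of_ne fun i _ hi => by_contra fun hv => hi (hp.1 i hv)).symm
  have hBmono : Monotone B := fun a b hab =>
    Fintype.piFinset_subset _ _ fun _ => Finset.range_mono (by omega)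
  have hBtop : Tendsto B atTop atTop :=
    tendsto_atTop_finset_of_monotone hBmono fun i =>
      ⟨Finset.univ.sup i, by simp [B, Finset.le_sup (f := i)]⟩
  have hle : ∀ n, k + 1 ≤ n → ∑ i ∈ B n, p i ≤ 1 := by
    intro n hn
    rw [hB, hp.sum_validUpTo, if_pos hn]
    linarith [mul_nonneg (outRate_pos hδ hn).le (hlev n)]
  have hsum : Summable p := by
    refine summable_of_sum_le (c := 1) hnn fun u => ?_
    obtain ⟨n, hn, hu⟩ := ((eventually_ge_atTop (k + 1)).and
      (hBtop.eventually (eventually_ge_atTop u))).exists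
    exact (Finset.sum_le_sum_of_subset_of_nonneg hu fun i _ _ => hnn i).trans (hle n hn)
  have hlim : Tendsto (fun n => ∑ i ∈ B n, p i) atTop (nhds (∑' i, p i)) :=
    hsum.hasSum.comp hBtop
  have hle_one : ∑' i, p i ≤ 1 :=
    le_of_tendsto hlim ((eventually_ge_atTop (k + 1)).mono hle)
  have hlevsum : Summable fun n => ∑ i ∈ validLevel k n, p i := by
    have h : ∀ n, ∑ m ∈ Finset.range (n + 1), ∑ i ∈ validLevel k m, p i
        = ∑ i ∈ validUpTo k n, p i := by
      intro n
      induction n with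
      | zero => simp [validUpTo_zero, validLevel]
      | succ n ih => rw [Finset.sum_range_succ, ih, sum_validUpTo_succ]
    refine summable_of_sum_range_le (c := 1) hlev fun n => ?_
    calc _ ≤ ∑ m ∈ Finset.range (n + k + 1 + 1), ∑ i ∈ validLevel k m, p i :=
          Finset.sum_le_sum_of_subset_of_nonneg (Finset.range_mono (by omega))
            fun m _ _ => hlev m
      _ ≤ 1 := by rw [h, ← hB]; exact hle _ (by omega)
  have hge_one : 1 - ∑' i, p i ≤ 0 := by
    refine nonpos_of_summable_of_eventually_le
      (C := (bcoef k δ 0 + |δ|) / tauc k δ) hlevsum ?_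
    filter_upwards [eventually_ge_atTop (k + 1)] with n hn
    have h1 : ∑ i ∈ B n, p i ≤ ∑' i, p i := hsum.sum_le_tsum _ fun i _ => hnn i
    rw [hB, hp.sum_validUpTo, if_pos hn] at h1
    have h2 := mul_le_mul_of_nonneg_right (outRate_le k hδ (n := n) (by omega)) (hlev n)
    linarith
  have : ∑' i, p i = 1 := by linarith
  exact this ▸ hsum.hasSum

/-- The limiting degree recursion has a unique solution, and any solution is a probability
mass function on `{1 ≤ i_k < ⋯ < i_0}`: it is nonnegative on valid index vectors (and
vanishes elsewhere) and sums to one. -/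
theorem limit_recursion_is_pmf (k : ℕ) (δ : ℝ) (hδ : -1 < δ) :
    (∃! p : (Fin (k + 1) → ℕ) → ℝ, LimitRecursion k δ p) ∧
    ∀ p : (Fin (k + 1) → ℕ) → ℝ, LimitRecursion k δ p →
      (∀ i, ValidIdx k i → 0 ≤ p i) ∧ HasSum p 1 := by
  refine ⟨?_, fun p hp => ⟨fun i _ => hp.nonneg hδ i, hp.hasSum hδ⟩⟩
  obtain ⟨p, hp⟩ := exists_limitRecursion k hδ
  exact ⟨p, hp, fun q hq => hq.unique hδ hp⟩
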